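/- arXiv:2003.11403 — 2 statements merged into one kernel-verified Lean document; each statement's English description precedes it below -/
import Mathlib

section
/- Let (S, ρ) be a complete separable metric space and V a divergence function on S. Let Q be a Markov transition kernel on S such that there exists α ∈ (0,1) with W_V(μ₁Q, μ₂Q) ≤ α · W_V(μ₁, μ₂) for all μ₁, μ₂ ∈ P_V(S), and suppose there is a nonempty set M ⊆ P_V(S) such that for every μ ∈ M there is c_μ < ∞ with sup_{k≥0} W_V(μQ^k, μ) ≤ c_μ. Then there exists a probability measure ϑ on S such that ϑQ = ϑ, and for every μ ∈ M the sequence μQ^k converges to ϑ in the Wasserstein divergence (W_V(μQ^k, ϑ) → 0); in particular ϑ is the same for all μ ∈ M and is the unique such limit. -/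
open MeasureTheory ProbabilityTheory Filter Topology
open scoped ENNReal NNReal

variable {S : Type*}

/-- `ξ` is a coupling of `μ₁` and `μ₂`: a Borel probability measure on `S × S`
whose first marginal is `μ₁` and second marginal is `μ₂`. -/
def IsCoupling [MeasurableSpace S] (ξ : Measure (S × S)) (μ₁ μ₂ : Measure S) : Prop :=
  IsProbabilityMeasure ξ ∧ ξ.map Prod.fst = μ₁ ∧ ξ.map Prod.snd = μ₂

/-- The Wasserstein divergence associated with a nonnegative function `V`:
`W_V(μ₁, μ₂) = inf over couplings ξ of ∫ V dξ`. -/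
noncomputable def WV [MeasurableSpace S] (V : S → S → ℝ) (μ₁ μ₂ : Measure S) : ℝ≥0∞ :=
  ⨅ (ξ : Measure (S × S)) (_ : IsCoupling ξ μ₁ μ₂),
    ∫⁻ p, ENNReal.ofReal (V p.1 p.2) ∂ξ

/-- One-step action of a Markov kernel on measures: `μ ↦ μQ`. -/
noncomputable def kernelStep [MeasurableSpace S] (Q : Kernel S S) (μ : Measure S) : Measure S :=
  μ.bind (fun s => Q s)

/-- The `k`-fold action `μ ↦ μQ^k`. -/
noncomputable def kernelIter [MeasurableSpace S] (Q : Kernel S S) (k : ℕ) (μ : Measure S) :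
    Measure S :=
  (kernelStep Q)^[k] μ

/-- A divergence function on a metric space: lower semicontinuous, nonnegative,
positive definite, symmetric, and inf-compact. -/
structure IsDivergence [MetricSpace S] (V : S → S → ℝ) : Prop where
  nonneg : ∀ s₁ s₂, 0 ≤ V s₁ s₂
  lsc : LowerSemicontinuous (fun p : S × S => V p.1 p.2)
  eq_zero_iff : ∀ s₁ s₂, V s₁ s₂ = 0 ↔ s₁ = s₂
  symm : ∀ s₁ s₂, V s₁ s₂ = V s₂ s₁
  infCompact : ∀ q : ℝ, 0 ≤ q → ∀ K : Set S, IsCompact K →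
    ∃ L : Set S, IsCompact L ∧ ∀ s₁ ∉ L, ∀ s₂ ∈ K, q ≤ V s₁ s₂

/-- `μ ∈ P_V(S)`: a Borel probability measure with a finite `V`-moment. -/
def MemPV [MeasurableSpace S] (V : S → S → ℝ) (μ : Measure S) : Prop :=
  IsProbabilityMeasure μ ∧ ∃ s₀ : S, ∫⁻ s, ENNReal.ofReal (V s s₀) ∂μ ≠ ⊤

section Aux

lemma aux_portmanteau {X : Type*} [MetricSpace X] [MeasurableSpace X] [BorelSpace X]
    {f : X → ℝ} (hf : LowerSemicontinuous f) (hf0 : ∀ x, 0 ≤ f x)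
    {μs : ℕ → ProbabilityMeasure X} {μ : ProbabilityMeasure X}
    (h : Tendsto μs atTop (𝓝 μ)) :
    ∫⁻ x, ENNReal.ofReal (f x) ∂(μ : Measure X) ≤
      atTop.liminf (fun i => ∫⁻ x, ENNReal.ofReal (f x) ∂(μs i : Measure X)) := by
  simp_rw [lintegral_eq_lintegral_meas_lt _ (Eventually.of_forall hf0) hf.measurable.aemeasurable]
  refine (lintegral_mono (fun t =>
    ProbabilityMeasure.le_liminf_measure_open_of_tendsto h (hf.isOpen_preimage t))).trans ?_
  refine lintegral_liminf_le (fun n => Antitone.measurable (fun s t hst => measure_mono ?_))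
  intro ω hω
  exact lt_of_le_of_lt hst hω

lemma aux_tight_range {X : Type*} [MetricSpace X] [CompleteSpace X] [SecondCountableTopology X]
    [MeasurableSpace X] [BorelSpace X]
    {μs : ℕ → ProbabilityMeasure X} {μ : ProbabilityMeasure X}
    (h : Tendsto μs atTop (𝓝 μ)) :
    IsTightMeasureSet (Set.range fun n => (μs n : Measure X)) := by
  have hc := h.isCompact_insert_range
  rw [← hc.isClosed.closure_eq] at hc
  refine (isTightMeasureSet_of_isCompact_closure hc).subset ?_
  rintro _ ⟨n, rfl⟩
  exact ⟨μs n, Or.inr ⟨n, rfl⟩, rfl⟩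

lemma aux_subseq {X : Type*} [MetricSpace X] [CompleteSpace X] [SecondCountableTopology X]
    [MeasurableSpace X] [BorelSpace X]
    {μs : ℕ → ProbabilityMeasure X}
    (h : IsTightMeasureSet (Set.range fun n => (μs n : Measure X))) :
    ∃ μ : ProbabilityMeasure X, ∃ φ : ℕ → ℕ, StrictMono φ ∧
      Tendsto (fun n => μs (φ n)) atTop (𝓝 μ) := by
  have hc : IsCompact (closure (Set.range μs)) := by
    apply isCompact_closure_of_isTightMeasureSet
    refine h.subset ?_
    rintro _ ⟨_, ⟨n, rfl⟩, rfl⟩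
    exact ⟨n, rfl⟩
  obtain ⟨μ, -, φ, hφ, hlim⟩ := hc.isSeqCompact (fun n => subset_closure (Set.mem_range_self n))
  exact ⟨μ, φ, hφ, hlim⟩

lemma aux_coupling_limit [MetricSpace S] [CompleteSpace S] [SecondCountableTopology S]
    [MeasurableSpace S] [BorelSpace S] {V : S → S → ℝ}
    (hV0 : ∀ s t, 0 ≤ V s t) (hV : LowerSemicontinuous (fun p : S × S => V p.1 p.2))
    {μs νs : ℕ → ProbabilityMeasure S} {μ ν : ProbabilityMeasure S}
    (hμ : Tendsto μs atTop (𝓝 μ)) (hν : Tendsto νs atTop (𝓝 ν))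
    {r : ℕ → ℝ≥0∞} {w : ℝ≥0∞} (hr : Tendsto r atTop (𝓝 w))
    (h : ∀ n, WV V (μs n : Measure S) (νs n : Measure S) < r n) :
    ∃ ξ : Measure (S × S), IsCoupling ξ (μ : Measure S) (ν : Measure S) ∧
      ∫⁻ p, ENNReal.ofReal (V p.1 p.2) ∂ξ ≤ w := by
  have hex : ∀ n, ∃ ξ : ProbabilityMeasure (S × S),
      (ξ : Measure (S × S)).map Prod.fst = μs n ∧ (ξ : Measure (S × S)).map Prod.snd = νs n ∧
      ∫⁻ p, ENNReal.ofReal (V p.1 p.2) ∂(ξ : Measure (S × S)) < r n := by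
    intro n
    have := h n
    simp only [WV, iInf_lt_iff] at this
    obtain ⟨ξ, ⟨h1, h2, h3⟩, h4⟩ := this
    exact ⟨⟨ξ, h1⟩, h2, h3, h4⟩
  choose ξ h1 h2 h3 using hex
  have ht : IsTightMeasureSet (Set.range fun n => (ξ n : Measure (S × S))) := by
    have tμ := isTightMeasureSet_iff_exists_isCompact_measure_compl_le.1 (aux_tight_range hμ)
    have tν := isTightMeasureSet_iff_exists_isCompact_measure_compl_le.1 (aux_tight_range hν)
    rw [isTightMeasureSet_iff_exists_isCompact_measure_compl_le]
    intro ε hε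
    have hε2 : 0 < ε / 2 := ENNReal.half_pos hε.ne'
    obtain ⟨K, hK, hKm⟩ := tμ _ hε2
    obtain ⟨L, hL, hLm⟩ := tν _ hε2
    refine ⟨K ×ˢ L, hK.prod hL, ?_⟩
    rintro _ ⟨n, rfl⟩
    have e1 := hKm _ ⟨n, rfl⟩
    have e2 := hLm _ ⟨n, rfl⟩
    simp only at e1 e2
    rw [← h1, Measure.map_apply measurable_fst hK.measurableSet.compl] at e1
    rw [← h2, Measure.map_apply measurable_snd hL.measurableSet.compl] at e2
    calc (ξ n : Measure (S × S)) (K ×ˢ L)ᶜ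
        ≤ (ξ n : Measure (S × S)) (Prod.fst ⁻¹' Kᶜ ∪ Prod.snd ⁻¹' Lᶜ) := by
          apply measure_mono
          intro p hp
          simp only [Set.mem_compl_iff, Set.mem_prod, not_and_or] at hp
          exact hp
      _ ≤ _ := measure_union_le _ _
      _ ≤ ε / 2 + ε / 2 := add_le_add e1 e2
      _ = ε := ENNReal.add_halves ε
  obtain ⟨η, φ, hφ, hlim⟩ := aux_subseq ht
  have key : ∀ (f : S × S → S) (hf : Continuous f) (ρs : ℕ → ProbabilityMeasure S)
      (ρ : ProbabilityMeasure S), Tendsto ρs atTop (𝓝 ρ) →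
      (∀ n, (ξ n : Measure (S × S)).map f = ρs n) → (η : Measure (S × S)).map f = ρ := by
    intro f hf ρs ρ hρ he
    have l1 := ProbabilityMeasure.tendsto_map_of_tendsto_of_continuous _ _ hlim hf
    have l2 := hρ.comp hφ.tendsto_atTop
    have : (fun n => (ξ (φ n)).map hf.measurable.aemeasurable) = ρs ∘ φ := by
      funext n
      apply Subtype.ext
      exact he (φ n)
    rw [this] at l1
    have l3 : η.map hf.measurable.aemeasurable = ρ := tendsto_nhds_unique l1 l2
    exact congrArg (fun x : ProbabilityMeasure S => (x : Measure S)) l3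
  refine ⟨η, ⟨inferInstance, key _ continuous_fst _ _ hμ h1, key _ continuous_snd _ _ hν h2⟩, ?_⟩
  refine (aux_portmanteau hV (fun p => hV0 _ _) hlim).trans ?_
  rw [← (hr.comp hφ.tendsto_atTop).liminf_eq]
  exact liminf_le_liminf (Eventually.of_forall fun n => (h3 (φ n)).le)

lemma aux_eq_of_zero [MetricSpace S] [SecondCountableTopology S]
    [MeasurableSpace S] [BorelSpace S] {V : S → S → ℝ}
    (hV0 : ∀ s t, 0 ≤ V s t) (hV : LowerSemicontinuous (fun p : S × S => V p.1 p.2))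
    (hVe : ∀ s t, V s t = 0 → s = t) {ξ : Measure (S × S)} {μ ν : Measure S}
    (h : IsCoupling ξ μ ν) (h0 : ∫⁻ p, ENNReal.ofReal (V p.1 p.2) ∂ξ ≤ 0) : μ = ν := by
  rw [nonpos_iff_eq_zero, lintegral_eq_zero_iff hV.measurable.ennreal_ofReal] at h0
  rw [← h.2.1, ← h.2.2]
  apply Measure.map_congr
  filter_upwards [h0] with p hp
  exact hVe _ _ (le_antisymm (ENNReal.ofReal_eq_zero.1 hp) (hV0 _ _))

lemma aux_tight_of_WV [MetricSpace S] [CompleteSpace S] [SecondCountableTopology S]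
    [MeasurableSpace S] [BorelSpace S] {V : S → S → ℝ} (hV : IsDivergence V)
    {μs : ℕ → ProbabilityMeasure S} {ν : ProbabilityMeasure S} {c : ℝ≥0∞} (hc : c ≠ ⊤)
    (h : ∀ n, WV V (μs n : Measure S) (ν : Measure S) ≤ c) :
    IsTightMeasureSet (Set.range fun n => (μs n : Measure S)) := by
  have tν := isTightMeasureSet_iff_exists_isCompact_measure_compl_le.1
    (isTightMeasureSet_singleton (μ := (ν : Measure S)))
  rw [isTightMeasureSet_iff_exists_isCompact_measure_compl_le]
  intro ε hε
  have hε2 : 0 < ε / 2 := ENNReal.half_pos hε.ne'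
  obtain ⟨K, hK, hKm⟩ := tν _ hε2
  have hKν := hKm _ rfl
  -- choose q
  obtain ⟨q, hq0, hq⟩ : ∃ q : ℝ, 0 < q ∧ (c + 1) / ENNReal.ofReal q ≤ ε / 2 := by
    rcases eq_or_ne ε ⊤ with rfl | hεt
    · exact ⟨1, one_pos, by simp [ENNReal.top_div]⟩
    have hε2t : ε / 2 ≠ ⊤ := (ENNReal.div_lt_top hεt (by simp)).ne
    have hn0 : (c + 1) / (ε / 2) ≠ ⊤ := (ENNReal.div_lt_top (by simp [hc]) hε2.ne').ne
    refine ⟨((c + 1) / (ε / 2)).toReal, ENNReal.toReal_pos ?_ hn0, ?_⟩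
    · simp [ENNReal.div_eq_zero_iff, hε2t]
    · rw [ENNReal.ofReal_toReal hn0]
      refine ENNReal.div_le_of_le_mul ?_
      rw [ENNReal.mul_div_cancel hε2.ne' hε2t]
  obtain ⟨L, hL, hLq⟩ := hV.infCompact q hq0.le K hK
  refine ⟨L, hL, ?_⟩
  rintro _ ⟨n, rfl⟩
  have hlt : WV V (μs n : Measure S) (ν : Measure S) < c + 1 :=
    lt_of_le_of_lt (h n) (ENNReal.lt_add_right hc one_ne_zero)
  simp only [WV, iInf_lt_iff] at hlt
  obtain ⟨ξ, ⟨h1, h2, h3⟩, h4⟩ := hlt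
  rw [← h3, Measure.map_apply measurable_snd hK.measurableSet.compl] at hKν
  simp only
  rw [← h2, Measure.map_apply measurable_fst hL.measurableSet.compl]
  have hmk := meas_ge_le_lintegral_div (μ := ξ) hV.lsc.measurable.ennreal_ofReal.aemeasurable
    (ENNReal.ofReal_pos.2 hq0).ne' ENNReal.ofReal_ne_top
  calc ξ (Prod.fst ⁻¹' Lᶜ)
      ≤ ξ ({p | ENNReal.ofReal q ≤ ENNReal.ofReal (V p.1 p.2)} ∪ Prod.snd ⁻¹' Kᶜ) := by
        apply measure_mono
        intro p hp
        by_cases hpK : p.2 ∈ K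
        · exact Or.inl (ENNReal.ofReal_le_ofReal (hLq _ hp _ hpK))
        · exact Or.inr hpK
    _ ≤ _ := measure_union_le _ _
    _ ≤ ε / 2 + ε / 2 := by
        refine add_le_add (hmk.trans (le_trans ?_ hq)) hKν
        gcongr
    _ = ε := ENNReal.add_halves ε

lemma aux_sum_cond [MeasurableSpace S] (ξ : Measure (S × S)) [IsProbabilityMeasure ξ]
    {g : S × S → ℕ} (hg : Measurable g) :
    Measure.sum (fun n => ξ (g ⁻¹' {n}) • ProbabilityTheory.cond ξ (g ⁻¹' {n})) = ξ := by
  have hB : ∀ n, MeasurableSet (g ⁻¹' {n}) := fun n => hg (measurableSet_singleton n)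
  have e : ∀ n, ξ (g ⁻¹' {n}) • ProbabilityTheory.cond ξ (g ⁻¹' {n})
      = ξ.restrict (g ⁻¹' {n}) := by
    intro n
    rw [ProbabilityTheory.cond, smul_smul]
    rcases eq_or_ne (ξ (g ⁻¹' {n})) 0 with h0 | h0
    · rw [Measure.restrict_eq_zero.2 h0, smul_zero]
    · rw [ENNReal.mul_inv_cancel h0 (measure_ne_top _ _), one_smul]
  simp_rw [e]
  rw [← Measure.restrict_iUnion (fun i j hij => ?_) hB]
  · have : (⋃ i, g ⁻¹' {i}) = Set.univ := by
      ext p; simp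
    rw [this, Measure.restrict_univ]
  · exact Disjoint.preimage g (by simpa using hij)

/-- Countable convexity of the Wasserstein divergence along a kernel. -/
lemma aux_glue [MeasurableSpace S] {V : S → S → ℝ} (K : Kernel S S) [IsMarkovKernel K]
    (ξ : Measure (S × S)) [IsProbabilityMeasure ξ] (g : S × S → ℕ) (hg : Measurable g)
    (f : ℕ → ℝ≥0∞) (hf : ∀ n, f n ≠ ⊤)
    (h : ∀ n, ξ (g ⁻¹' {n}) ≠ 0 →
      WV V (kernelStep K ((ProbabilityTheory.cond ξ (g ⁻¹' {n})).map Prod.fst))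
        (kernelStep K ((ProbabilityTheory.cond ξ (g ⁻¹' {n})).map Prod.snd)) ≤ f n) :
    WV V (kernelStep K (ξ.map Prod.fst)) (kernelStep K (ξ.map Prod.snd)) ≤
      ∑' n, ξ (g ⁻¹' {n}) * f n := by
  have hB : ∀ n, MeasurableSet (g ⁻¹' {n}) := fun n => hg (measurableSet_singleton n)
  have hsum := aux_sum_cond ξ hg
  have hmass : ∑' n, ξ (g ⁻¹' {n}) = 1 := by
    rw [← measure_iUnion (fun i j hij => Disjoint.preimage g (by simpa using hij)) hB]
    have : (⋃ i, g ⁻¹' {i}) = Set.univ := by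
      ext p; simp
    rw [this, measure_univ]
  apply ENNReal.le_of_forall_pos_le_add
  intro ε hε _
  have hex : ∀ n, ∃ η : Measure (S × S), ξ (g ⁻¹' {n}) ≠ 0 →
      IsCoupling η (kernelStep K ((ProbabilityTheory.cond ξ (g ⁻¹' {n})).map Prod.fst))
        (kernelStep K ((ProbabilityTheory.cond ξ (g ⁻¹' {n})).map Prod.snd)) ∧
      ∫⁻ p, ENNReal.ofReal (V p.1 p.2) ∂η ≤ f n + ε := by
    intro n
    by_cases h0 : ξ (g ⁻¹' {n}) = 0
    · exact ⟨0, fun h => absurd h0 h⟩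
    have hlt := lt_of_le_of_lt (h n h0)
      (ENNReal.lt_add_right (hf n) (ENNReal.coe_ne_zero.2 hε.ne'))
    simp only [WV, iInf_lt_iff] at hlt
    obtain ⟨η, h1, h2⟩ := hlt
    exact ⟨η, fun _ => ⟨h1, h2.le⟩⟩
  choose η hη using hex
  have marg : ∀ (π : S × S → S) (hπ : Measurable π),
      (∀ n, ξ (g ⁻¹' {n}) ≠ 0 → (η n).map π =
        kernelStep K ((ProbabilityTheory.cond ξ (g ⁻¹' {n})).map π)) →
      (Measure.sum (fun n => ξ (g ⁻¹' {n}) • η n)).map π = kernelStep K (ξ.map π) := by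
    intro π hπ he
    conv_rhs => rw [← hsum]
    rw [Measure.map_sum hπ.aemeasurable, Measure.map_sum hπ.aemeasurable]
    unfold kernelStep
    rw [Measure.bind_sum _ _ K.measurable.aemeasurable]
    congr 1
    funext n
    rw [Measure.map_smul, Measure.map_smul, Measure.bind_smul]
    rcases eq_or_ne (ξ (g ⁻¹' {n})) 0 with h0 | h0
    · rw [h0, zero_smul, zero_smul]
    · rw [he n h0]; rfl
  have hη1 : (Measure.sum (fun n => ξ (g ⁻¹' {n}) • η n)) Set.univ = 1 := by
    rw [Measure.sum_apply _ MeasurableSet.univ, ← hmass]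
    congr 1
    funext n
    rcases eq_or_ne (ξ (g ⁻¹' {n})) 0 with h0 | h0
    · simp [h0]
    · have := (hη n h0).1.1
      simp
  refine le_trans (iInf₂_le (Measure.sum (fun n => ξ (g ⁻¹' {n}) • η n))
    ⟨⟨hη1⟩, marg _ measurable_fst fun n hn => (hη n hn).1.2.1,
      marg _ measurable_snd fun n hn => (hη n hn).1.2.2⟩) ?_
  rw [lintegral_sum_measure]
  calc ∑' n, ∫⁻ p, ENNReal.ofReal (V p.1 p.2) ∂(ξ (g ⁻¹' {n}) • η n)
      ≤ ∑' n, (ξ (g ⁻¹' {n}) * f n + ξ (g ⁻¹' {n}) * ε) := by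
        apply ENNReal.tsum_le_tsum
        intro n
        rw [lintegral_smul_measure, ← mul_add, smul_eq_mul]
        rcases eq_or_ne (ξ (g ⁻¹' {n})) 0 with h0 | h0
        · simp [h0]
        · gcongr
          exact (hη n h0).2
    _ = _ := by rw [ENNReal.tsum_add, ENNReal.tsum_mul_right, hmass, one_mul]

lemma aux_symm_le [MetricSpace S] [SecondCountableTopology S]
    [MeasurableSpace S] [BorelSpace S] {V : S → S → ℝ} (hV : IsDivergence V) (μ ν : Measure S) :
    WV V μ ν ≤ WV V ν μ := by
  refine le_iInf₂ fun ξ hξ => ?_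
  have hp := hξ.1
  have hc : IsCoupling (ξ.map Prod.swap) μ ν := by
    refine ⟨Measure.isProbabilityMeasure_map measurable_swap.aemeasurable, ?_, ?_⟩
    · rw [Measure.map_map measurable_fst measurable_swap]
      exact hξ.2.2
    · rw [Measure.map_map measurable_snd measurable_swap]
      exact hξ.2.1
  refine (iInf₂_le (ξ.map Prod.swap) hc).trans ?_
  rw [lintegral_map hV.lsc.measurable.ennreal_ofReal measurable_swap]
  refine lintegral_mono fun p => ?_
  simp only [Prod.fst_swap, Prod.snd_swap]
  rw [hV.symm]

lemma aux_symm [MetricSpace S] [SecondCountableTopology S]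
    [MeasurableSpace S] [BorelSpace S] {V : S → S → ℝ} (hV : IsDivergence V) (μ ν : Measure S) :
    WV V μ ν = WV V ν μ :=
  le_antisymm (aux_symm_le hV μ ν) (aux_symm_le hV ν μ)

lemma aux_WV_min_le [MeasurableSpace S] {V : S → S → ℝ} (μ ν : Measure S)
    [IsProbabilityMeasure μ] [IsProbabilityMeasure ν] :
    WV (fun s t => min (V s t) 1) μ ν ≤ 1 := by
  have hc : IsCoupling (μ.prod ν) μ ν := by
    refine ⟨inferInstance, ?_, ?_⟩
    · rw [Measure.map_fst_prod]; simp
    · rw [Measure.map_snd_prod]; simp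
  refine (iInf₂_le (μ.prod ν) hc).trans ?_
  refine (lintegral_mono (g := fun _ => 1) fun p => ?_).trans (by simp)
  exact ENNReal.ofReal_le_one.2 (min_le_right _ _)

lemma aux_step_prob [MeasurableSpace S] (Q : Kernel S S) [IsMarkovKernel Q] (μ : Measure S)
    [IsProbabilityMeasure μ] : IsProbabilityMeasure (kernelStep Q μ) := by
  constructor
  rw [kernelStep, Measure.bind_apply MeasurableSet.univ Q.measurable.aemeasurable]
  simp

lemma aux_iter_prob [MeasurableSpace S] (Q : Kernel S S) [IsMarkovKernel Q] (μ : Measure S)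
    [IsProbabilityMeasure μ] (k : ℕ) : IsProbabilityMeasure (kernelIter Q k μ) := by
  induction k with
  | zero => simpa [kernelIter]
  | succ k ih =>
    rw [kernelIter, Function.iterate_succ_apply']
    have : IsProbabilityMeasure ((kernelStep Q)^[k] μ) := ih
    exact aux_step_prob Q _

lemma aux_iter_kernel [MeasurableSpace S] (Q : Kernel S S) [IsMarkovKernel Q] (k : ℕ) :
    ∃ K : Kernel S S, IsMarkovKernel K ∧ ∀ μ : Measure S, kernelIter Q k μ = kernelStep K μ := by
  induction k with
  | zero =>
    refine ⟨Kernel.id, inferInstance, fun μ => ?_⟩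
    simp [kernelIter, kernelStep]
  | succ k ih =>
    obtain ⟨K, hK, h⟩ := ih
    refine ⟨Q ∘ₖ K, inferInstance, fun μ => ?_⟩
    have h' : (kernelStep Q)^[k] μ = kernelStep K μ := h μ
    rw [kernelIter, Function.iterate_succ_apply', h', kernelStep, kernelStep,
      Measure.bind_bind K.measurable.aemeasurable Q.measurable.aemeasurable]
    rfl

lemma aux_cond_bound [MeasurableSpace S] (ξ : Measure (S × S)) [IsProbabilityMeasure ξ]
    {h : S × S → ℝ} (hm : Measurable (fun p => ⌊h p⌋₊)) {f : S × S → ℝ}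
    (hf : ∀ p, f p ≤ h p) (n : ℕ) :
    ∫⁻ p, ENNReal.ofReal (f p) ∂(ProbabilityTheory.cond ξ ((fun p => ⌊h p⌋₊) ⁻¹' {n}))
      ≤ (n : ℝ≥0∞) + 1 := by
  rcases eq_or_ne (ξ ((fun p => ⌊h p⌋₊) ⁻¹' {n})) 0 with h0 | h0
  · rw [ProbabilityTheory.cond_eq_zero_of_meas_eq_zero h0]
    simp
  have := ProbabilityTheory.cond_isProbabilityMeasure h0
  have hae := ProbabilityTheory.ae_cond_mem (μ := ξ) (hm (measurableSet_singleton n))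
  calc _ ≤ ∫⁻ p, ((n : ℝ≥0∞) + 1)
        ∂(ProbabilityTheory.cond ξ ((fun p => ⌊h p⌋₊) ⁻¹' {n})) := by
        apply lintegral_mono_ae
        filter_upwards [hae] with p hp
        have hp' : ⌊h p⌋₊ = n := hp
        have h1 : f p ≤ ((n + 1 : ℕ) : ℝ) := by
          have := Nat.lt_floor_add_one (h p)
          rw [hp'] at this
          push_cast
          linarith [hf p]
        calc ENNReal.ofReal (f p) ≤ ENNReal.ofReal ((n + 1 : ℕ) : ℝ) :=
              ENNReal.ofReal_le_ofReal h1
          _ = _ := by rw [ENNReal.ofReal_natCast]; push_cast; rfl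
    _ = _ := by simp

lemma aux_contr [MetricSpace S] [SecondCountableTopology S]
    [MeasurableSpace S] [BorelSpace S] {V : S → S → ℝ} (hV : IsDivergence V)
    (Q : Kernel S S) [IsMarkovKernel Q] {α : ℝ} (hα0 : 0 < α)
    (hcontr : ∀ μ₁ μ₂ : Measure S, MemPV V μ₁ → MemPV V μ₂ →
      WV V (kernelStep Q μ₁) (kernelStep Q μ₂) ≤ ENNReal.ofReal α * WV V μ₁ μ₂)
    (μ ν : Measure S) [IsProbabilityMeasure μ] [IsProbabilityMeasure ν] :
    WV V (kernelStep Q μ) (kernelStep Q ν) ≤ ENNReal.ofReal α * WV V μ ν := by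
  have : Nonempty S := nonempty_of_isProbabilityMeasure μ
  obtain ⟨s₀⟩ := this
  have hmV : Measurable (fun p : S × S => V p.1 p.2) := hV.lsc.measurable
  have hm1 : Measurable (fun p : S × S => V p.1 s₀) :=
    hmV.comp (measurable_fst.prodMk measurable_const)
  have hm0 : Measurable (fun s : S => V s s₀) :=
    hmV.comp (measurable_id.prodMk measurable_const)
  have hm2 : Measurable (fun p : S × S => V p.2 s₀) :=
    hmV.comp (measurable_snd.prodMk measurable_const)
  have hmh : Measurable (fun p : S × S => ⌊V p.1 p.2 + V p.1 s₀ + V p.2 s₀⌋₊) :=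
    Nat.measurable_floor.comp ((hmV.add hm1).add hm2)
  rw [WV.eq_1 V μ ν]
  simp_rw [ENNReal.mul_iInf_of_ne (a := ENNReal.ofReal α) (ENNReal.ofReal_pos.2 hα0).ne' ENNReal.ofReal_ne_top]
  refine le_iInf₂ ?_
  rintro ξ ⟨hξ, rfl, rfl⟩
  have hfin : ∀ (f : S × S → ℝ), (∀ p, f p ≤ V p.1 p.2 + V p.1 s₀ + V p.2 s₀) → ∀ n,
      ∫⁻ p, ENNReal.ofReal (f p) ∂(ProbabilityTheory.cond ξ
        ((fun p : S × S => ⌊V p.1 p.2 + V p.1 s₀ + V p.2 s₀⌋₊) ⁻¹' {n})) ≠ ⊤ := by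
    intro f hf n
    exact ne_top_of_le_ne_top (by simp) (aux_cond_bound ξ hmh hf n)
  refine (aux_glue (V := V) Q ξ _ hmh (fun n => ENNReal.ofReal α *
    ∫⁻ p, ENNReal.ofReal (V p.1 p.2) ∂(ProbabilityTheory.cond ξ
        ((fun p : S × S => ⌊V p.1 p.2 + V p.1 s₀ + V p.2 s₀⌋₊) ⁻¹' {n}))) ?_ ?_).trans ?_
  · intro n
    refine ENNReal.mul_ne_top ENNReal.ofReal_ne_top (hfin _ (fun p => ?_) n)
    linarith [hV.nonneg p.1 s₀, hV.nonneg p.2 s₀]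
  · intro n hn
    have hp := ProbabilityTheory.cond_isProbabilityMeasure hn
    refine (hcontr _ _ ⟨Measure.isProbabilityMeasure_map measurable_fst.aemeasurable, s₀, ?_⟩
      ⟨Measure.isProbabilityMeasure_map measurable_snd.aemeasurable, s₀, ?_⟩).trans ?_
    · rw [lintegral_map hm0.ennreal_ofReal measurable_fst]
      refine hfin _ (fun p => ?_) n
      linarith [hV.nonneg p.1 p.2, hV.nonneg p.2 s₀]
    · rw [lintegral_map hm0.ennreal_ofReal measurable_snd]
      refine hfin _ (fun p => ?_) n
      linarith [hV.nonneg p.1 p.2, hV.nonneg p.1 s₀]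
    · gcongr
      exact iInf₂_le _ ⟨hp, rfl, rfl⟩
  · conv_rhs => rw [← aux_sum_cond ξ hmh]
    rw [lintegral_sum_measure, ← ENNReal.tsum_mul_left]
    refine ENNReal.tsum_le_tsum fun n => ?_
    rw [lintegral_smul_measure, smul_eq_mul, mul_left_comm]

lemma aux_contr_iter [MetricSpace S] [SecondCountableTopology S]
    [MeasurableSpace S] [BorelSpace S] {V : S → S → ℝ} (hV : IsDivergence V)
    (Q : Kernel S S) [IsMarkovKernel Q] {α : ℝ} (hα0 : 0 < α)
    (hcontr : ∀ μ₁ μ₂ : Measure S, MemPV V μ₁ → MemPV V μ₂ →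
      WV V (kernelStep Q μ₁) (kernelStep Q μ₂) ≤ ENNReal.ofReal α * WV V μ₁ μ₂)
    (μ ν : Measure S) [IsProbabilityMeasure μ] [IsProbabilityMeasure ν] (k : ℕ) :
    WV V (kernelIter Q k μ) (kernelIter Q k ν) ≤ ENNReal.ofReal α ^ k * WV V μ ν := by
  induction k with
  | zero => simp [kernelIter]
  | succ k ih =>
    have := aux_iter_prob Q μ k
    have := aux_iter_prob Q ν k
    have h := aux_contr hV Q hα0 hcontr (kernelIter Q k μ) (kernelIter Q k ν)
    rw [kernelIter, kernelIter, Function.iterate_succ_apply', Function.iterate_succ_apply']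
    refine h.trans ?_
    rw [pow_succ', mul_assoc]
    gcongr

lemma aux_WV_trunc [MetricSpace S] [SecondCountableTopology S]
    [MeasurableSpace S] [BorelSpace S] {V : S → S → ℝ} (hV : IsDivergence V)
    (Q : Kernel S S) [IsMarkovKernel Q] {α : ℝ} (hα0 : 0 < α) (hα1 : α < 1)
    (hcontr : ∀ μ₁ μ₂ : Measure S, MemPV V μ₁ → MemPV V μ₂ →
      WV V (kernelStep Q μ₁) (kernelStep Q μ₂) ≤ ENNReal.ofReal α * WV V μ₁ μ₂)
    (μ ν : Measure S) [IsProbabilityMeasure μ] [IsProbabilityMeasure ν] :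
    Tendsto (fun k => WV (fun s t => min (V s t) 1) (kernelIter Q k μ) (kernelIter Q k ν))
      atTop (𝓝 0) := by
  have hmV : Measurable (fun p : S × S => V p.1 p.2) := hV.lsc.measurable
  have hmh : Measurable (fun p : S × S => ⌊V p.1 p.2⌋₊) := Nat.measurable_floor.comp hmV
  have hle : ∀ k, WV (fun s t => min (V s t) 1) (kernelIter Q k μ) (kernelIter Q k ν) ≤
      ∑' n : ℕ, (μ.prod ν) ((fun p : S × S => ⌊V p.1 p.2⌋₊) ⁻¹' {n}) *
        min 1 (ENNReal.ofReal α ^ k * ((n : ℝ≥0∞) + 1)) := by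
    intro k
    obtain ⟨K, hK, hKe⟩ := aux_iter_kernel Q k
    have := aux_glue (V := fun s t => min (V s t) 1) K (μ.prod ν) _ hmh
      (fun n => min 1 (ENNReal.ofReal α ^ k * ((n : ℝ≥0∞) + 1)))
      (fun n => ne_top_of_le_ne_top ENNReal.one_ne_top (min_le_left _ _)) ?_
    · rw [← hKe, ← hKe] at this
      simpa [Measure.map_fst_prod, Measure.map_snd_prod] using this
    · intro n hn
      have hp := ProbabilityTheory.cond_isProbabilityMeasure hn
      have hp1 := Measure.isProbabilityMeasure_map (μ := ProbabilityTheory.cond (μ.prod ν)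
        ((fun p : S × S => ⌊V p.1 p.2⌋₊) ⁻¹' {n})) measurable_fst.aemeasurable
      have hp2 := Measure.isProbabilityMeasure_map (μ := ProbabilityTheory.cond (μ.prod ν)
        ((fun p : S × S => ⌊V p.1 p.2⌋₊) ⁻¹' {n})) measurable_snd.aemeasurable
      rw [← hKe, ← hKe]
      refine le_min ?_ ?_
      · have := aux_iter_prob Q ((ProbabilityTheory.cond (μ.prod ν)
          ((fun p : S × S => ⌊V p.1 p.2⌋₊) ⁻¹' {n})).map Prod.fst) k
        have := aux_iter_prob Q ((ProbabilityTheory.cond (μ.prod ν)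
          ((fun p : S × S => ⌊V p.1 p.2⌋₊) ⁻¹' {n})).map Prod.snd) k
        exact aux_WV_min_le _ _
      · refine le_trans ?_ ((aux_contr_iter hV Q hα0 hcontr
          ((ProbabilityTheory.cond (μ.prod ν)
          ((fun p : S × S => ⌊V p.1 p.2⌋₊) ⁻¹' {n})).map Prod.fst)
          ((ProbabilityTheory.cond (μ.prod ν)
          ((fun p : S × S => ⌊V p.1 p.2⌋₊) ⁻¹' {n})).map Prod.snd) k).trans ?_)
        · exact iInf₂_mono fun ξ _ => lintegral_mono fun p =>
            ENNReal.ofReal_le_ofReal (min_le_left _ _)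
        · gcongr
          refine (iInf₂_le _ ⟨hp, rfl, rfl⟩).trans ?_
          exact aux_cond_bound _ hmh (fun p => le_rfl) n
  refine tendsto_of_tendsto_of_tendsto_of_le_of_le tendsto_const_nhds ?_ (fun _ => zero_le) hle
  have hmass : ∑' n : ℕ, (μ.prod ν) ((fun p : S × S => ⌊V p.1 p.2⌋₊) ⁻¹' {n}) ≠ ⊤ := by
    rw [← measure_iUnion (fun i j hij => Disjoint.preimage _ (by simpa using hij))
      (fun n => hmh (measurableSet_singleton n))]
    exact measure_ne_top _ _
  simp_rw [← lintegral_count]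
  have := tendsto_lintegral_of_dominated_convergence (μ := Measure.count)
    (F := fun k n => (μ.prod ν) ((fun p : S × S => ⌊V p.1 p.2⌋₊) ⁻¹' {n}) *
        min 1 (ENNReal.ofReal α ^ k * ((n : ℝ≥0∞) + 1)))
    (f := fun _ => 0)
    (fun n : ℕ => (μ.prod ν) ((fun p : S × S => ⌊V p.1 p.2⌋₊) ⁻¹' {n}))
    (fun k => measurable_of_countable _)
    (fun k => Eventually.of_forall fun n => mul_le_of_le_one_right zero_le (min_le_left _ _))
    (by rwa [lintegral_count]) (Eventually.of_forall fun n => ?_)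
  · simpa using this
  · have h1 : Tendsto (fun k : ℕ => ENNReal.ofReal α ^ k) atTop (𝓝 0) :=
      ENNReal.tendsto_pow_atTop_nhds_zero_of_lt_one (by simpa using hα1)
    have h2 : Tendsto (fun k : ℕ => ENNReal.ofReal α ^ k * ((n : ℝ≥0∞) + 1)) atTop (𝓝 0) := by
      simpa using ENNReal.Tendsto.mul_const h1 (b := (n : ℝ≥0∞) + 1) (Or.inr (by simp))
    have h3 : Tendsto (fun k : ℕ => min 1 (ENNReal.ofReal α ^ k * ((n : ℝ≥0∞) + 1))) atTop
        (𝓝 0) := by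
      simpa using (tendsto_const_nhds (x := (1 : ℝ≥0∞))).min h2
    simpa using ENNReal.Tendsto.const_mul h3 (Or.inr (measure_ne_top (μ.prod ν) _))

/-- A tight sequence converging in divergence converges weakly. -/
lemma aux_weak [MetricSpace S] [CompleteSpace S] [SecondCountableTopology S]
    [MeasurableSpace S] [BorelSpace S] {V : S → S → ℝ} (hV : IsDivergence V)
    {μs : ℕ → ProbabilityMeasure S} {ν : ProbabilityMeasure S}
    (ht : IsTightMeasureSet (Set.range fun n => (μs n : Measure S)))
    (h : Tendsto (fun n => WV V (μs n : Measure S) (ν : Measure S)) atTop (𝓝 0)) :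
    Tendsto μs atTop (𝓝 ν) := by
  apply tendsto_of_subseq_tendsto
  intro ns hns
  obtain ⟨ρ, φ, hφ, hlim⟩ := aux_subseq (μs := fun n => μs (ns n)) (ht.subset (by
    rintro _ ⟨n, rfl⟩
    exact ⟨ns n, rfl⟩))
  refine ⟨φ, ?_⟩
  have h' : Tendsto (fun n => WV V (μs (ns (φ n)) : Measure S) (ν : Measure S)) atTop (𝓝 0) :=
    h.comp (hns.comp hφ.tendsto_atTop)
  have hev : ∀ᶠ n in atTop, WV V (μs (ns (φ n)) : Measure S) (ν : Measure S) < ⊤ :=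
    h'.eventually_lt_const ENNReal.zero_lt_top
  obtain ⟨N, hN⟩ := eventually_atTop.1 hev
  have hu : Tendsto (fun n : ℕ => ((n : ℝ≥0∞))⁻¹) atTop (𝓝 0) :=
    ENNReal.tendsto_inv_nat_nhds_zero
  obtain ⟨ξ, hξ, hξ0⟩ := aux_coupling_limit hV.nonneg hV.lsc
    (hlim.comp (tendsto_add_atTop_nat N)) (tendsto_const_nhds (x := ν))
    (r := fun n => WV V (μs (ns (φ (n + N))) : Measure S) (ν : Measure S) + ((n : ℝ≥0∞))⁻¹)
    (w := 0)
    (by simpa using (h'.comp (tendsto_add_atTop_nat N)).add hu)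
    (fun n => ENNReal.lt_add_right (hN _ (Nat.le_add_left N n)).ne (by simp))
  have := aux_eq_of_zero hV.nonneg hV.lsc (fun s t => (hV.eq_zero_iff s t).1) hξ hξ0
  have : ρ = ν := Subtype.ext this
  rwa [← this]

lemma aux_lsc_min [MetricSpace S] {V : S → S → ℝ}
    (hV : LowerSemicontinuous (fun p : S × S => V p.1 p.2)) :
    LowerSemicontinuous (fun p : S × S => min (V p.1 p.2) 1) := by
  intro x y hy
  have := hV x y (lt_of_lt_of_le hy (min_le_left _ _))
  filter_upwards [this] with p hp
  exact lt_min hp (lt_of_lt_of_le hy (min_le_right _ _))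

lemma aux_main [MetricSpace S] [CompleteSpace S] [SecondCountableTopology S]
    [MeasurableSpace S] [BorelSpace S] {V : S → S → ℝ} (hV : IsDivergence V)
    (Q : Kernel S S) [IsMarkovKernel Q] {α : ℝ} (hα0 : 0 < α) (hα1 : α < 1)
    (hcontr : ∀ μ₁ μ₂ : Measure S, MemPV V μ₁ → MemPV V μ₂ →
      WV V (kernelStep Q μ₁) (kernelStep Q μ₂) ≤ ENNReal.ofReal α * WV V μ₁ μ₂)
    (μ : ProbabilityMeasure S) (c : ℝ≥0∞) (hc : c ≠ ⊤)
    (h : ∀ k, WV V (kernelIter Q k (μ : Measure S)) (μ : Measure S) ≤ c)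
    (μs : ℕ → ProbabilityMeasure S) (hμs : ∀ k, (μs k : Measure S) = kernelIter Q k μ) :
    IsTightMeasureSet (Set.range fun n => (μs n : Measure S)) ∧
    ∃ ϑ : ProbabilityMeasure S, kernelStep Q (ϑ : Measure S) = ϑ ∧
      Tendsto μs atTop (𝓝 ϑ) ∧
      Tendsto (fun k => WV V (kernelIter Q k (μ : Measure S)) (ϑ : Measure S)) atTop (𝓝 0) := by
  have ht : IsTightMeasureSet (Set.range fun n => (μs n : Measure S)) :=
    aux_tight_of_WV hV (ν := μ) hc (fun n => by rw [hμs]; exact h n)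
  refine ⟨ht, ?_⟩
  obtain ⟨ϑ, φ, hφ, hlim⟩ := aux_subseq ht
  have hpow : Tendsto (fun k : ℕ => ENNReal.ofReal α ^ k) atTop (𝓝 0) :=
    ENNReal.tendsto_pow_atTop_nhds_zero_of_lt_one (by simpa using hα1)
  have hWn : ∀ n, WV V (μs n : Measure S) (ϑ : Measure S) ≤
      ENNReal.ofReal α ^ n * c := by
    intro n
    have hfin : ENNReal.ofReal α ^ n * c ≠ ⊤ :=
      ENNReal.mul_ne_top (ENNReal.pow_ne_top ENNReal.ofReal_ne_top) hc
    have hb : ∀ j, WV V (μs n : Measure S) (μs (n + j) : Measure S) ≤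
        ENNReal.ofReal α ^ n * c := by
      intro j
      have hp := aux_iter_prob Q (μ : Measure S) j
      have h1 := aux_contr_iter hV Q hα0 hcontr (μ : Measure S) (kernelIter Q j (μ : Measure S)) n
      rw [hμs, hμs]
      have e : kernelIter Q (n + j) (μ : Measure S) =
          kernelIter Q n (kernelIter Q j (μ : Measure S)) := by
        simp only [kernelIter, Function.iterate_add_apply]
      rw [e]
      refine h1.trans ?_
      gcongr
      rw [aux_symm hV]
      exact h j
    have hu : Tendsto (fun j : ℕ => ENNReal.ofReal α ^ n * c + ((j : ℝ≥0∞))⁻¹) atTop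
        (𝓝 (ENNReal.ofReal α ^ n * c)) := by
      simpa using (tendsto_const_nhds (x := ENNReal.ofReal α ^ n * c)).add
        ENNReal.tendsto_inv_nat_nhds_zero
    obtain ⟨ξ, hξ, hξ0⟩ := aux_coupling_limit hV.nonneg hV.lsc
      (tendsto_const_nhds (x := μs n)) (hlim.comp (tendsto_add_atTop_nat n)) hu
      (fun j => lt_of_le_of_lt (b := ENNReal.ofReal α ^ n * c) (by
        have hge : n ≤ φ (j + n) := le_trans (by omega) (hφ.le_apply (x := j + n))
        obtain ⟨i, hi⟩ := Nat.exists_eq_add_of_le hge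
        simp only [Function.comp]
        rw [hi]
        exact hb i) (ENNReal.lt_add_right hfin (by simp)))
    exact (iInf₂_le ξ hξ).trans hξ0
  have hW0 : Tendsto (fun k => WV V (μs k : Measure S) (ϑ : Measure S)) atTop (𝓝 0) := by
    refine tendsto_of_tendsto_of_tendsto_of_le_of_le tendsto_const_nhds ?_
      (fun _ => zero_le) hWn
    simpa using ENNReal.Tendsto.mul_const hpow (b := c) (Or.inr hc)
  have hw := aux_weak hV ht hW0
  have hpQ := aux_step_prob Q (ϑ : Measure S)
  refine ⟨ϑ, ?_, hw, ?_⟩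
  · have hQ0 : Tendsto (fun k => WV V (μs (k + 1) : Measure S)
        ((⟨kernelStep Q (ϑ : Measure S), hpQ⟩ : ProbabilityMeasure S) : Measure S))
        atTop (𝓝 0) := by
      refine tendsto_of_tendsto_of_tendsto_of_le_of_le tendsto_const_nhds
        (h := fun k => ENNReal.ofReal α * WV V (μs k : Measure S) (ϑ : Measure S)) ?_
        (fun _ => zero_le) (fun k => ?_)
      · simpa using ENNReal.Tendsto.const_mul hW0 (a := ENNReal.ofReal α)
          (Or.inr ENNReal.ofReal_ne_top)
      · have e : (μs (k + 1) : Measure S) = kernelStep Q (μs k : Measure S) := by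
          rw [hμs, hμs, kernelIter, Function.iterate_succ_apply']
          rfl
        simp only [e]
        exact aux_contr hV Q hα0 hcontr _ _
    have hw2 := aux_weak hV (μs := fun k => μs (k + 1)) (ht.subset (by
      rintro _ ⟨n, rfl⟩
      exact ⟨n + 1, rfl⟩)) hQ0
    have heq := tendsto_nhds_unique hw2 (hw.comp (tendsto_add_atTop_nat 1))
    exact congrArg (fun x : ProbabilityMeasure S => (x : Measure S)) heq
  · simpa only [hμs] using hW0

end Aux

/-- Existence and uniqueness of an invariant distribution for a Markov kernel that is a
contraction with respect to the Wasserstein divergence, together with convergence of the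
marginals to it. -/
theorem exists_unique_invariant_of_WV_contraction
    [MetricSpace S] [CompleteSpace S] [TopologicalSpace.SeparableSpace S]
    [MeasurableSpace S] [BorelSpace S]
    (V : S → S → ℝ) (hV : IsDivergence V)
    (Q : Kernel S S) [IsMarkovKernel Q]
    (α : ℝ) (hα0 : 0 < α) (hα1 : α < 1)
    (hcontr : ∀ μ₁ μ₂ : Measure S, MemPV V μ₁ → MemPV V μ₂ →
      WV V (kernelStep Q μ₁) (kernelStep Q μ₂) ≤ ENNReal.ofReal α * WV V μ₁ μ₂)
    (M : Set (Measure S)) (hMne : M.Nonempty) (hMPV : ∀ μ ∈ M, MemPV V μ)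
    (hbdd : ∀ μ ∈ M, ∃ c : ℝ≥0∞, c ≠ ⊤ ∧ ∀ k : ℕ, WV V (kernelIter Q k μ) μ ≤ c) :
    ∃ ϑ : Measure S, IsProbabilityMeasure ϑ ∧ kernelStep Q ϑ = ϑ ∧
      (∀ μ ∈ M, Tendsto (fun k => WV V (kernelIter Q k μ) ϑ) atTop (𝓝 0)) ∧
      (∀ ϑ' : Measure S, IsProbabilityMeasure ϑ' →
        (∃ μ ∈ M, Tendsto (fun k => WV V (kernelIter Q k μ) ϑ') atTop (𝓝 0)) →
        ϑ' = ϑ) := by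
  have hsc : SecondCountableTopology S := UniformSpace.secondCountable_of_separable S
  have hseq : ∀ μ ∈ M, ∃ μs : ℕ → ProbabilityMeasure S,
      ∀ k, (μs k : Measure S) = kernelIter Q k μ := by
    intro μ hμ
    have := (hMPV μ hμ).1
    exact ⟨fun k => ⟨kernelIter Q k μ, aux_iter_prob Q μ k⟩, fun k => rfl⟩
  have hkey : ∀ μ ∈ M, ∀ μs : ℕ → ProbabilityMeasure S,
      (∀ k, (μs k : Measure S) = kernelIter Q k μ) →
      IsTightMeasureSet (Set.range fun n => (μs n : Measure S)) ∧
      ∃ ϑ : ProbabilityMeasure S, kernelStep Q (ϑ : Measure S) = ϑ ∧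
        Tendsto μs atTop (𝓝 ϑ) ∧
        Tendsto (fun k => WV V (kernelIter Q k μ) (ϑ : Measure S)) atTop (𝓝 0) := by
    intro μ hμ μs hμs
    obtain ⟨c, hc, h⟩ := hbdd μ hμ
    exact aux_main hV Q hα0 hα1 hcontr ⟨μ, (hMPV μ hμ).1⟩ c hc h μs hμs
  obtain ⟨μ₀, hμ₀⟩ := hMne
  obtain ⟨μs, hμs⟩ := hseq μ₀ hμ₀
  obtain ⟨-, ϑ, hinv, hw, -⟩ := hkey μ₀ hμ₀ μs hμs
  -- all limits coincide
  have hsame : ∀ ν ∈ M, ∀ νs : ℕ → ProbabilityMeasure S,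
      (∀ k, (νs k : Measure S) = kernelIter Q k ν) → ∀ ϑ' : ProbabilityMeasure S,
      Tendsto νs atTop (𝓝 ϑ') → ϑ' = ϑ := by
    intro ν hν νs hνs ϑ' hw'
    have := (hMPV μ₀ hμ₀).1
    have := (hMPV ν hν).1
    have ht := aux_WV_trunc hV Q hα0 hα1 hcontr ν μ₀
    obtain ⟨N, hN⟩ := eventually_atTop.1 (ht.eventually_lt_const ENNReal.zero_lt_top)
    obtain ⟨ξ, hξ, hξ0⟩ := aux_coupling_limit (V := fun s t => min (V s t) 1)
      (fun s t => le_min (hV.nonneg s t) zero_le_one) (aux_lsc_min hV.lsc)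
      (hw'.comp (tendsto_add_atTop_nat N)) (hw.comp (tendsto_add_atTop_nat N))
      (r := fun n => WV (fun s t => min (V s t) 1) (kernelIter Q (n + N) ν)
        (kernelIter Q (n + N) μ₀) + ((n : ℝ≥0∞))⁻¹) (w := 0)
      (by simpa using (ht.comp (tendsto_add_atTop_nat N)).add ENNReal.tendsto_inv_nat_nhds_zero)
      (fun n => by
        simp only [Function.comp, hνs, hμs]
        exact ENNReal.lt_add_right (hN _ (by omega)).ne (by simp))
    refine Subtype.ext (aux_eq_of_zero (V := fun s t => min (V s t) 1)
      (fun s t => le_min (hV.nonneg s t) zero_le_one) (aux_lsc_min hV.lsc) (fun s t hst => ?_)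
      hξ hξ0)
    apply (hV.eq_zero_iff s t).1
    rcases min_choice (V s t) 1 with h | h
    · rw [← h]; exact hst
    · rw [h] at hst; exact absurd hst one_ne_zero
  refine ⟨ϑ, inferInstance, hinv, ?_, ?_⟩
  · intro ν hν
    obtain ⟨νs, hνs⟩ := hseq ν hν
    obtain ⟨-, ϑ', -, hw', hW'⟩ := hkey ν hν νs hνs
    rw [hsame ν hν νs hνs ϑ' hw'] at hW'
    exact hW'
  · rintro ϑ' hp ⟨ν, hν, hW'⟩
    obtain ⟨νs, hνs⟩ := hseq ν hν
    obtain ⟨ht, -⟩ := hkey ν hν νs hνs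
    have hw' := aux_weak hV (ν := ⟨ϑ', hp⟩) ht (by
      simp only [hνs]
      exact hW')
    exact congrArg (fun x : ProbabilityMeasure S => (x : Measure S)) (hsame ν hν νs hνs _ hw')
end

section
/- Let (S, ρ) be a complete separable metric space and V a divergence function on S. Let {μ_k} ⊆ P_V(S) be a Cauchy sequence under the Wasserstein divergence, i.e., for every ε > 0 there exists K_ε ∈ ℕ such that W_V(μ_k, μ_{k+l}) < ε for all k ≥ K_ε and all l ∈ ℕ. Then there exists a Borel probability measure θ on S such that W_V(μ_k, θ) → 0 as k → ∞; moreover μ_k converges to θ in the weak* sense. Additionally, if {μ_k} and {ν_k} are two sequences of Borel probability measures converging in the Wasserstein divergence to θ_μ and θ_ν respectively, and lim_{k→∞} W_V(μ_k, ν_k) = 0, then θ_μ = θ_ν. -/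
open MeasureTheory ProbabilityTheory Filter Topology
open scoped ENNReal NNReal

variable {S : Type*}

lemma WV_comm_le [MetricSpace S] [TopologicalSpace.SeparableSpace S]
    [MeasurableSpace S] [BorelSpace S]
    (V : S → S → ℝ) (hV : IsDivergence V) (μ ν : Measure S) : WV V μ ν ≤ WV V ν μ := by
  have : SecondCountableTopology S := UniformSpace.secondCountable_of_separable S
  have hVm : Measurable (fun p : S × S => V p.1 p.2) := hV.lsc.measurable
  unfold WV
  refine le_iInf₂ fun ξ hξ => ?_
  obtain ⟨h0, h1, h2⟩ := hξ
  have hc : IsCoupling (ξ.map Prod.swap) μ ν := by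
    refine ⟨?_, ?_, ?_⟩
    · exact Measure.isProbabilityMeasure_map measurable_swap.aemeasurable
    · rw [Measure.map_map measurable_fst measurable_swap]; exact h2
    · rw [Measure.map_map measurable_snd measurable_swap]; exact h1
  refine (iInf₂_le (ξ.map Prod.swap) hc).trans ?_
  rw [lintegral_map hVm.ennreal_ofReal measurable_swap]
  exact lintegral_mono fun p => by simp [hV.symm p.1 p.2]

lemma exists_coupling_le [MetricSpace S] [MeasurableSpace S] (V : S → S → ℝ) (P Q : ProbabilityMeasure S)
    {c : ℝ≥0∞} {ε : ℝ≥0∞} (hε : ε ≠ 0) (h : WV V P Q ≤ c) :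
    ∃ ξ : ProbabilityMeasure (S × S), IsCoupling (ξ : Measure (S × S)) P Q ∧
      ∫⁻ p, ENNReal.ofReal (V p.1 p.2) ∂(ξ : Measure (S × S)) ≤ c + ε := by
  by_cases hc : c = ⊤
  · refine ⟨⟨(P : Measure S).prod Q, inferInstance⟩, ⟨Subtype.property _, ?_, ?_⟩, by simp [hc]⟩
    · simp
    · simp
  · have : WV V P Q < c + ε := h.trans_lt (ENNReal.lt_add_right hc hε)
    unfold WV at this
    simp only [iInf_lt_iff] at this
    obtain ⟨ξ, hξ, hlt⟩ := this
    exact ⟨⟨ξ, hξ.1⟩, hξ, hlt.le⟩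

lemma lsc_lintegral_le_liminf {Ω : Type*} [MeasurableSpace Ω] [TopologicalSpace Ω]
    [OpensMeasurableSpace Ω]
    {μ : Measure Ω} {μs : ℕ → Measure Ω} {f : Ω → ℝ} (hf : LowerSemicontinuous f) (f_nn : 0 ≤ f)
    (h_opens : ∀ G, IsOpen G → μ G ≤ atTop.liminf (fun i ↦ μs i G)) :
    ∫⁻ x, ENNReal.ofReal (f x) ∂μ ≤ atTop.liminf (fun i ↦ ∫⁻ x, ENNReal.ofReal (f x) ∂(μs i)) := by
  simp_rw [lintegral_eq_lintegral_meas_lt _ (Eventually.of_forall f_nn) hf.measurable.aemeasurable]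
  calc ∫⁻ (t : ℝ) in Set.Ioi 0, μ {a | t < f a}
      ≤ ∫⁻ (t : ℝ) in Set.Ioi 0, atTop.liminf (fun i ↦ (μs i) {a | t < f a}) :=
        lintegral_mono (fun t ↦ h_opens _ (hf.isOpen_preimage t))
    _ ≤ atTop.liminf (fun i ↦ ∫⁻ (t : ℝ) in Set.Ioi 0, (μs i) {a | t < f a}) :=
        lintegral_liminf_le (fun n ↦ Antitone.measurable (fun s t hst ↦
            measure_mono (fun ω hω ↦ lt_of_le_of_lt hst hω)))

lemma tight_range_of_tendsto [MetricSpace S] [CompleteSpace S] [TopologicalSpace.SeparableSpace S]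
    [MeasurableSpace S] [BorelSpace S] {P : ℕ → ProbabilityMeasure S} {p : ProbabilityMeasure S}
    (h : Tendsto P atTop (𝓝 p)) :
    IsTightMeasureSet {((μ : ProbabilityMeasure S) : Measure S) | μ ∈ Set.range P} := by
  have : SecondCountableTopology S := UniformSpace.secondCountable_of_separable S
  apply isTightMeasureSet_of_isCompact_closure
  exact h.isCompact_insert_range.closure_of_subset (Set.subset_insert _ _)

lemma exists_coupling_limit [MetricSpace S] [CompleteSpace S] [TopologicalSpace.SeparableSpace S]
    [MeasurableSpace S] [BorelSpace S]
    (V : S → S → ℝ) (hV : IsDivergence V) {P Q : ℕ → ProbabilityMeasure S}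
    {p q : ProbabilityMeasure S} (hP : Tendsto P atTop (𝓝 p)) (hQ : Tendsto Q atTop (𝓝 q))
    {c : ℕ → ℝ≥0∞} {c' : ℝ≥0∞} (hc : Tendsto c atTop (𝓝 c')) (h : ∀ k, WV V (P k) (Q k) ≤ c k) :
    ∃ ξ : Measure (S × S), IsCoupling ξ p q ∧ ∫⁻ p, ENNReal.ofReal (V p.1 p.2) ∂ξ ≤ c' := by
  have : SecondCountableTopology S := UniformSpace.secondCountable_of_separable S
  have hex : ∀ k : ℕ, ∃ ξ : ProbabilityMeasure (S × S),
      IsCoupling (ξ : Measure (S × S)) (P k) (Q k) ∧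
      ∫⁻ p, ENNReal.ofReal (V p.1 p.2) ∂(ξ : Measure (S × S)) ≤ c k + ((k : ℝ≥0∞))⁻¹ :=
    fun k => exists_coupling_le V (P k) (Q k) (by simp) (h k)
  choose ξ hξ hle using hex
  have htight : IsTightMeasureSet
      {((μ : ProbabilityMeasure (S × S)) : Measure (S × S)) | μ ∈ Set.range ξ} := by
    apply IsTightMeasureSet.prodMk
    · refine (tight_range_of_tendsto hP).subset ?_
      rintro _ ⟨_, ⟨_, ⟨k, rfl⟩, rfl⟩, rfl⟩
      exact ⟨P k, ⟨k, rfl⟩, (hξ k).2.1.symm⟩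
    · refine (tight_range_of_tendsto hQ).subset ?_
      rintro _ ⟨_, ⟨_, ⟨k, rfl⟩, rfl⟩, rfl⟩
      exact ⟨Q k, ⟨k, rfl⟩, (hξ k).2.2.symm⟩
  obtain ⟨ζ, -, φ, hφ, hlim⟩ := (isCompact_closure_of_isTightMeasureSet htight).tendsto_subseq
    (x := ξ) (fun n => subset_closure ⟨n, rfl⟩)
  refine ⟨ζ, ⟨inferInstance, ?_, ?_⟩, ?_⟩
  · have h1 := ProbabilityMeasure.tendsto_map_of_tendsto_of_continuous _ _ hlim continuous_fst
    have h2 : Tendsto (fun i => P (φ i)) atTop (𝓝 p) := hP.comp hφ.tendsto_atTop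
    have h3 : (fun i => ((ξ ∘ φ) i).map (continuous_fst (X := S) (Y := S)).measurable.aemeasurable)
        = fun i => P (φ i) := by
      funext i
      apply Subtype.ext
      exact (hξ (φ i)).2.1
    rw [h3] at h1
    have h4 := tendsto_nhds_unique h1 h2
    exact congrArg (fun μ : ProbabilityMeasure S => (μ : Measure S)) h4
  · have h1 := ProbabilityMeasure.tendsto_map_of_tendsto_of_continuous _ _ hlim continuous_snd
    have h2 : Tendsto (fun i => Q (φ i)) atTop (𝓝 q) := hQ.comp hφ.tendsto_atTop
    have h3 : (fun i => ((ξ ∘ φ) i).map (continuous_snd (X := S) (Y := S)).measurable.aemeasurable)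
        = fun i => Q (φ i) := by
      funext i
      apply Subtype.ext
      exact (hξ (φ i)).2.2
    rw [h3] at h1
    have h4 := tendsto_nhds_unique h1 h2
    exact congrArg (fun μ : ProbabilityMeasure S => (μ : Measure S)) h4
  · have hl : Tendsto (fun k => c k + ((k : ℝ≥0∞))⁻¹) atTop (𝓝 c') := by
      simpa using hc.add ENNReal.tendsto_inv_nat_nhds_zero
    have hl2 := hl.comp hφ.tendsto_atTop
    refine (lsc_lintegral_le_liminf (μs := fun i => ((ξ (φ i) : ProbabilityMeasure (S × S)) :
      Measure (S × S))) hV.lsc (fun p => hV.nonneg _ _) (fun G hG =>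
      ProbabilityMeasure.le_liminf_measure_open_of_tendsto hlim hG)).trans ?_
    rw [← hl2.liminf_eq]
    exact liminf_le_liminf (Eventually.of_forall fun i => hle (φ i))

lemma eq_of_coupling_zero [MetricSpace S] [TopologicalSpace.SeparableSpace S]
    [MeasurableSpace S] [BorelSpace S]
    (V : S → S → ℝ) (hV : IsDivergence V) {μ ν : Measure S} {ξ : Measure (S × S)}
    (hξ : IsCoupling ξ μ ν) (h : ∫⁻ p, ENNReal.ofReal (V p.1 p.2) ∂ξ ≤ 0) : μ = ν := by
  have : SecondCountableTopology S := UniformSpace.secondCountable_of_separable S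
  have hVm : Measurable (fun p : S × S => V p.1 p.2) := hV.lsc.measurable
  have h0 := (lintegral_eq_zero_iff hVm.ennreal_ofReal).1 (le_antisymm h bot_le)
  rw [← hξ.2.1, ← hξ.2.2]
  apply Measure.map_congr
  filter_upwards [h0] with p hp
  have : V p.1 p.2 ≤ 0 := by simpa using hp
  exact (hV.eq_zero_iff _ _).1 (le_antisymm this (hV.nonneg _ _))

lemma compact_closure_of_WV [MetricSpace S] [CompleteSpace S] [TopologicalSpace.SeparableSpace S]
    [MeasurableSpace S] [BorelSpace S]
    (V : S → S → ℝ) (hV : IsDivergence V) (P : ℕ → ProbabilityMeasure S)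
    (h : ∀ ε : ℝ≥0∞, 0 < ε → ∃ (K : ℕ) (ν : ProbabilityMeasure S), ∀ k ≥ K, WV V ν (P k) < ε) :
    IsCompact (closure (Set.range P)) := by
  have : SecondCountableTopology S := UniformSpace.secondCountable_of_separable S
  apply isCompact_closure_of_isTightMeasureSet
  rw [isTightMeasureSet_iff_exists_isCompact_measure_compl_le]
  intro ε hε
  have hε2 : 0 < ε / 2 := ENNReal.half_pos hε.ne'
  obtain ⟨N, ν, hN⟩ := h (ε / 2) hε2
  have hfin : IsTightMeasureSet
      {((μ : ProbabilityMeasure S) : Measure S) | μ ∈ P '' (Set.Iio N)} := by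
    apply isTightMeasureSet_of_isCompact_closure
    have hf : (P '' (Set.Iio N)).Finite := (Set.finite_Iio N).image P
    rw [hf.isClosed.closure_eq]
    exact hf.isCompact
  obtain ⟨K₁, hK₁, hK₁le⟩ :=
    isTightMeasureSet_iff_exists_isCompact_measure_compl_le.1 hfin ε hε
  obtain ⟨C, hC, hCle⟩ := isTightMeasureSet_iff_exists_isCompact_measure_compl_le.1
    (isTightMeasureSet_singleton (μ := (ν : Measure S))) (ε / 2) hε2
  obtain ⟨L, hL, hLV⟩ := hV.infCompact 1 zero_le_one C hC
  refine ⟨K₁ ∪ L, hK₁.union hL, ?_⟩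
  rintro _ ⟨_, ⟨k, rfl⟩, rfl⟩
  rcases lt_or_ge k N with hk | hk
  · exact (measure_mono (Set.compl_subset_compl.2 Set.subset_union_left)).trans
      (hK₁le _ ⟨P k, ⟨k, hk, rfl⟩, rfl⟩)
  · refine (measure_mono (Set.compl_subset_compl.2 Set.subset_union_right)).trans ?_
    have hlt := hN k hk
    unfold WV at hlt
    simp only [iInf_lt_iff] at hlt
    obtain ⟨ξ, ⟨h0, h1, h2⟩, hlt⟩ := hlt
    have hVm : Measurable (fun p : S × S => V p.1 p.2) := hV.lsc.measurable
    have hmarkov := meas_ge_le_lintegral_div (μ := ξ)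
      (f := fun p : S × S => ENNReal.ofReal (V p.1 p.2)) hVm.ennreal_ofReal.aemeasurable
      one_ne_zero ENNReal.one_ne_top
    rw [div_one] at hmarkov
    have hCν := hCle _ rfl
    rw [← h1, Measure.map_apply measurable_fst hC.measurableSet.compl] at hCν
    rw [← h2, Measure.map_apply measurable_snd hL.measurableSet.compl]
    calc ξ (Prod.snd ⁻¹' Lᶜ)
        ≤ ξ ((Prod.fst ⁻¹' Cᶜ) ∪ {p | 1 ≤ ENNReal.ofReal (V p.1 p.2)}) := by
          apply measure_mono
          intro p hp
          by_cases hpC : p.1 ∈ C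
          · right
            have := hLV p.2 hp p.1 hpC
            rw [hV.symm] at this
            simpa using this
          · left; exact hpC
      _ ≤ ε / 2 + ε / 2 := (measure_union_le _ _).trans (add_le_add hCν (hmarkov.trans hlt.le))
      _ = ε := ENNReal.add_halves ε

lemma tendsto_of_WV [MetricSpace S] [CompleteSpace S] [TopologicalSpace.SeparableSpace S]
    [MeasurableSpace S] [BorelSpace S]
    (V : S → S → ℝ) (hV : IsDivergence V) (P : ℕ → ProbabilityMeasure S) (θ : ProbabilityMeasure S)
    (h : Tendsto (fun k => WV V (P k) θ) atTop (𝓝 0)) : Tendsto P atTop (𝓝 θ) := by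
  have hcomp := compact_closure_of_WV V hV P (fun ε hε => by
    obtain ⟨K, hK⟩ := eventually_atTop.1 (h.eventually_lt_const hε)
    exact ⟨K, θ, fun k hk => (WV_comm_le V hV _ _).trans_lt (hK k hk)⟩)
  apply tendsto_of_subseq_tendsto
  intro ns hns
  obtain ⟨θ', -, φ, hφ, hlim⟩ := hcomp.tendsto_subseq (x := P ∘ ns)
    (fun n => subset_closure ⟨ns n, rfl⟩)
  obtain ⟨ξ, hξ, hle⟩ := exists_coupling_limit V hV hlim (tendsto_const_nhds (x := θ))
    ((h.comp hns).comp hφ.tendsto_atTop) (fun k => le_rfl)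
  have : θ' = θ := Subtype.ext (eq_of_coupling_zero V hV hξ hle)
  exact ⟨φ, this ▸ hlim⟩

/-- Cauchy sequences in the Wasserstein divergence converge (to a probability measure, also in
the weak* sense), and two Wasserstein-divergence convergent sequences whose mutual divergence
tends to zero have the same limit. -/
theorem cauchy_WV_converges_and_limits_unique
    [MetricSpace S] [CompleteSpace S] [TopologicalSpace.SeparableSpace S]
    [MeasurableSpace S] [BorelSpace S]
    (V : S → S → ℝ) (hV : IsDivergence V) :
    (∀ μ : ℕ → Measure S, (∀ k, MemPV V (μ k)) →
      (∀ ε : ℝ, 0 < ε → ∃ Kε : ℕ, ∀ k ≥ Kε, ∀ l : ℕ,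
        WV V (μ k) (μ (k + l)) < ENNReal.ofReal ε) →
      ∃ θ : Measure S, IsProbabilityMeasure θ ∧
        Tendsto (fun k => WV V (μ k) θ) atTop (𝓝 0) ∧
        ∀ f : BoundedContinuousFunction S ℝ,
          Tendsto (fun k => ∫ x, f x ∂(μ k)) atTop (𝓝 (∫ x, f x ∂θ))) ∧
    (∀ (μ ν : ℕ → Measure S) (θμ θν : Measure S),
      (∀ k, IsProbabilityMeasure (μ k)) → (∀ k, IsProbabilityMeasure (ν k)) →
      IsProbabilityMeasure θμ → IsProbabilityMeasure θν →
      Tendsto (fun k => WV V (μ k) θμ) atTop (𝓝 0) →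
      Tendsto (fun k => WV V (ν k) θν) atTop (𝓝 0) →
      Tendsto (fun k => WV V (μ k) (ν k)) atTop (𝓝 0) →
      θμ = θν) := by
  constructor
  · intro μ hμ hC
    let P : ℕ → ProbabilityMeasure S := fun k => ⟨μ k, (hμ k).1⟩
    have hC' : ∀ ε : ℝ≥0∞, 0 < ε → ∃ K : ℕ, ∀ k ≥ K, ∀ l : ℕ, WV V (μ k) (μ (k + l)) < ε := by
      intro ε hε
      obtain ⟨r, hr, hrε⟩ := ENNReal.lt_iff_exists_real_btwn.1 hε
      obtain ⟨K, hK⟩ := hC r (by simpa using hrε.1)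
      exact ⟨K, fun k hk l => (hK k hk l).trans hrε.2⟩
    have hcomp := compact_closure_of_WV V hV P (fun ε hε => by
      obtain ⟨K, hK⟩ := hC' ε hε
      refine ⟨K, P K, fun k hk => ?_⟩
      have := hK K le_rfl (k - K)
      rwa [Nat.add_sub_cancel' hk] at this)
    obtain ⟨θ, -, φ, hφ, hlim⟩ := hcomp.tendsto_subseq (x := P)
      (fun n => subset_closure ⟨n, rfl⟩)
    have hW : Tendsto (fun k => WV V (P k) θ) atTop (𝓝 0) := by
      rw [ENNReal.tendsto_nhds_zero]
      intro ε hε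
      obtain ⟨K, hK⟩ := hC' ε hε
      filter_upwards [eventually_ge_atTop K] with k hk
      have hlim' : Tendsto (fun j => P (φ (j + k))) atTop (𝓝 θ) :=
        hlim.comp (tendsto_add_atTop_nat k)
      obtain ⟨ξ, hξ, hle⟩ := exists_coupling_limit V hV (tendsto_const_nhds (x := P k)) hlim'
        (tendsto_const_nhds (x := ε)) (fun j => by
          have h1 : k ≤ φ (j + k) := (Nat.le_add_left k j).trans (hφ.id_le _)
          have := hK k hk (φ (j + k) - k)
          rw [Nat.add_sub_cancel' h1] at this
          exact this.le)
      exact (iInf₂_le ξ hξ).trans hle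
    refine ⟨θ, inferInstance, hW, ?_⟩
    exact ProbabilityMeasure.tendsto_iff_forall_integral_tendsto.1 (tendsto_of_WV V hV P θ hW)
  · intro μ ν θμ θν hμ hν hθμ hθν h1 h2 h3
    let P : ℕ → ProbabilityMeasure S := fun k => ⟨μ k, hμ k⟩
    let Q : ℕ → ProbabilityMeasure S := fun k => ⟨ν k, hν k⟩
    obtain ⟨ξ, hξ, hle⟩ := exists_coupling_limit V hV
      (tendsto_of_WV V hV P ⟨θμ, hθμ⟩ h1) (tendsto_of_WV V hV Q ⟨θν, hθν⟩ h2) h3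
      (fun k => le_rfl)
    exact eq_of_coupling_zero V hV hξ hle
end
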